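/- Let α⁺, α⁻, λ⁻ > 0 and λ⁺ > λ⁻ + 2 (so that λ⁺ > 1 and the hypergeometric series below converge). Let Z ~ Γ(α⁺,λ⁺;α⁻,λ⁻) and K > 0. Then the at-the-money European Call Option price satisfies E[(K e^{Z} − K)⁺] = [K (λ⁺)^{α⁺}(λ⁻)^{α⁻} Γ(α⁺+α⁻) / (Γ(α⁺) Γ(α⁻+1))] · ( ₂F₁(α⁺+α⁻, α⁻; α⁻+1; −(λ⁻+1)/(λ⁺−1)) / (λ⁺−1)^{α⁺+α⁻} − ₂F₁(α⁺+α⁻, α⁻; α⁻+1; −λ⁻/λ⁺) / (λ⁺)^{α⁺+α⁻} ), where x⁺ = max(x,0). -/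

import Mathlib

open MeasureTheory ProbabilityTheory

/-- The bilateral Gamma distribution `Γ(α⁺,λ⁺;α⁻,λ⁻)`: the law of `X − Y` for independent
`X ~ Γ(α⁺,λ⁺)`, `Y ~ Γ(α⁻,λ⁻)`. -/
noncomputable def bilateralGammaMeasure (ap lp am lm : ℝ) : Measure ℝ :=
  ((gammaMeasure ap lp).prod (gammaMeasure am lm)).map (fun p => p.1 - p.2)

open Set

/-- The generalized binomial theorem, with coefficients written through Pochhammer symbols. -/
lemma hasSum_ascPochhammer_mul_pow (s : ℝ) {z : ℝ} (hz : |z| < 1) :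
    HasSum (fun n : ℕ => (n.factorial : ℝ)⁻¹ * (ascPochhammer ℝ n).eval s * z ^ n)
      ((1 - z) ^ (-s)) := by
  have h := (Real.one_add_rpow_hasFPowerSeriesOnBall_zero (a := -s)).hasSum (y := -z)
    (by simpa [← ofReal_norm] using hz)
  rw [binomialSeries_eq_ordinaryHypergeometricSeries (b := (1 : ℝ))
    (fun k => by have : (0 : ℝ) ≤ k := k.cast_nonneg; linarith), neg_neg, zero_add,
    ← sub_eq_add_neg] at h
  convert! h using 1
  ext n
  have h1 : (ascPochhammer ℝ n).eval 1 ≠ 0 := (ascPochhammer_pos n _ one_pos).ne'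
  rw [FormalMultilinearSeries.compContinuousLinearMap_apply]
  have h2 : (⇑(-ContinuousLinearMap.id ℝ ℝ) ∘ fun _ : Fin n => -z) = fun _ => z := by
    ext
    simp
  rw [h2, ordinaryHypergeometricSeries_apply_eq, mul_inv_cancel_right₀ h1, smul_eq_mul]

/-- Telescoping of a ratio of Pochhammer symbols. -/
lemma ascPochhammer_eval_mul_inv_eval_add_one {a : ℝ} (ha : 0 < a) (n : ℕ) :
    (ascPochhammer ℝ n).eval a * ((ascPochhammer ℝ n).eval (a + 1))⁻¹ = a / (a + n) := by
  have h1 : (ascPochhammer ℝ n).eval (a + 1) ≠ 0 := (ascPochhammer_pos n _ (by linarith)).ne'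
  have h2 : a + n ≠ 0 := by positivity
  have h3 : a * (ascPochhammer ℝ n).eval (a + 1) = (ascPochhammer ℝ n).eval a * (a + n) := by
    rw [← ascPochhammer_succ_eval, ascPochhammer_succ_left]
    simp
  field_simp
  linarith

lemma integrableOn_rpow_mul_one_sub_mul_rpow (s : ℝ) {a z : ℝ} (ha : 0 < a) (hz : |z| < 1) :
    IntegrableOn (fun u : ℝ => u ^ (a - 1) * (1 - z * u) ^ (-s)) (Ioo 0 1) := by
  have h : IntervalIntegrable (fun u : ℝ => u ^ (a - 1) * (1 - z * u) ^ (-s)) volume 0 1 := by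
    refine (intervalIntegral.intervalIntegrable_rpow' (by linarith)).mul_continuousOn ?_
    refine ContinuousOn.rpow_const (by fun_prop) fun u hu => Or.inl ?_
    rw [uIcc_of_le zero_le_one] at hu
    have := abs_lt.1 hz
    nlinarith [hu.1, hu.2]
  rw [intervalIntegrable_iff_integrableOn_Ioo_of_le zero_le_one] at h
  exact h

/-- Euler's integral for `₂F₁ s a (a + 1)`. -/
lemma integral_rpow_mul_one_sub_mul_rpow (s : ℝ) {a z : ℝ} (ha : 0 < a) (hz : |z| < 1) :
    ∫ u in Ioo (0 : ℝ) 1, u ^ (a - 1) * (1 - z * u) ^ (-s) = ₂F₁ s a (a + 1) z / a := by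
  have hpow (n : ℕ) : ∫ u in Ioo (0 : ℝ) 1, u ^ (a - 1) * u ^ n = (a + n)⁻¹ := by
    have : ∀ u ∈ Ioo (0 : ℝ) 1, u ^ (a - 1) * u ^ n = u ^ (a + n - 1) := fun u hu => by
      rw [← Real.rpow_natCast, ← Real.rpow_add hu.1]
      ring_nf
    rw [setIntegral_congr_fun measurableSet_Ioo this, ← integral_Ioc_eq_integral_Ioo,
      ← intervalIntegral.integral_of_le zero_le_one, integral_rpow (Or.inl (by
        have : (0 : ℝ) ≤ n := n.cast_nonneg
        linarith))]
    have : a + n ≠ 0 := by positivity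
    simp [Real.zero_rpow this]
  have hint (n : ℕ) : IntegrableOn (fun u : ℝ => u ^ (a - 1) * u ^ n) (Ioo 0 1) := by
    by_contra h
    have h2 := hpow n
    rw [integral_undef h] at h2
    have : 0 < (a + n)⁻¹ := by positivity
    linarith
  set c : ℕ → ℝ := fun n => (n.factorial : ℝ)⁻¹ * (ascPochhammer ℝ n).eval s * z ^ n with hc
  have hsum : Summable fun n => |c n| := (hasSum_ascPochhammer_mul_pow s hz).summable.abs
  have key := hasSum_integral_of_summable_integral_norm (μ := volume.restrict (Ioo (0 : ℝ) 1))
    (F := fun n u => c n * (u ^ (a - 1) * u ^ n)) (fun n => (hint n).const_mul _) (by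
      have (n : ℕ) : ∫ u in Ioo (0 : ℝ) 1, ‖c n * (u ^ (a - 1) * u ^ n)‖ = |c n| * (a + n)⁻¹ := by
        rw [← hpow, ← integral_const_mul]
        refine setIntegral_congr_fun measurableSet_Ioo fun u hu => ?_
        have := Real.rpow_nonneg hu.1.le (a - 1)
        have := pow_nonneg hu.1.le n
        simp only [Real.norm_eq_abs, abs_mul, abs_of_nonneg, *]
      simp_rw [this]
      refine (hsum.mul_right a⁻¹).of_nonneg_of_le (fun n => by positivity) fun n => ?_
      gcongr
      simp)
  have hF (u : ℝ) (hu : u ∈ Ioo (0 : ℝ) 1) :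
      ∑' n, c n * (u ^ (a - 1) * u ^ n) = u ^ (a - 1) * (1 - z * u) ^ (-s) := by
    have hzu : |z * u| < 1 := by
      rw [abs_mul, abs_of_pos hu.1]
      nlinarith [abs_nonneg z, hu.1, hu.2]
    rw [← (hasSum_ascPochhammer_mul_pow s hzu).tsum_eq, ← tsum_mul_left]
    refine tsum_congr fun n => ?_
    simp only [hc, mul_pow]
    ring
  rw [setIntegral_congr_fun measurableSet_Ioo hF] at key
  rw [← key.tsum_eq, ordinaryHypergeometric_eq_tsum, ← tsum_div_const]
  refine tsum_congr fun n => ?_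
  rw [integral_const_mul, hpow, mul_assoc _ _ (Polynomial.eval _ _)⁻¹,
    ascPochhammer_eval_mul_inv_eval_add_one ha]
  simp only [hc, smul_eq_mul]
  field_simp

lemma lintegral_rpow_mul_exp_neg_mul_Ioi {a r : ℝ} (ha : 0 < a) (hr : 0 < r) :
    ∫⁻ x in Ioi (0 : ℝ), ENNReal.ofReal (x ^ (a - 1) * Real.exp (-(r * x)))
      = ENNReal.ofReal (r ^ (-a) * Real.Gamma a) := by
  have h := Real.integral_rpow_mul_exp_neg_mul_Ioi ha hr
  rw [one_div, Real.inv_rpow hr.le, ← Real.rpow_neg hr.le] at h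
  rw [← h, ofReal_integral_eq_lintegral_ofReal]
  · by_contra hi
    rw [integral_undef hi] at h
    have := Real.Gamma_pos_of_pos ha
    have : 0 < r ^ (-a) * Real.Gamma a := by positivity
    linarith
  · refine ae_restrict_of_forall_mem measurableSet_Ioi fun x (hx : 0 < x) => ?_
    simp only [Pi.zero_apply]
    positivity

lemma lintegral_eq_ofReal_mul_lintegral_comp_mul_left {x : ℝ} (hx : 0 < x)
    {f : ℝ → ENNReal} (hf : Measurable f) :
    ∫⁻ y, f y = ∫⁻ u, ENNReal.ofReal x * f (x * u) := by
  conv_lhs => rw [← Real.smul_map_volume_mul_left hx.ne', abs_of_pos hx]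
  rw [lintegral_smul_measure, lintegral_map hf (by fun_prop), lintegral_const_mul _ (by fun_prop),
    smul_eq_mul]

lemma lintegral_gammaPDF_mul_indicator_exp {a r t x : ℝ} (ha : 0 < a) (hr : 0 < r) (hx : 0 < x) :
    ∫⁻ y, gammaPDF a r y *
        (Ioi (0 : ℝ)).indicator (fun z => ENNReal.ofReal (Real.exp (t * z))) (x - y)
      = ∫⁻ u in Ioo (0 : ℝ) 1, ENNReal.ofReal
          (r ^ a / Real.Gamma a * u ^ (a - 1) * (x ^ a * Real.exp (t * x - (r + t) * u * x))) := by
  have hm : Measurable ((Ioi (0 : ℝ)).indicator fun z => ENNReal.ofReal (Real.exp (t * z))) :=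
    Measurable.indicator (by fun_prop) measurableSet_Ioi
  have hp : Measurable (gammaPDF a r) := (measurable_gammaPDFReal a r).ennreal_ofReal
  rw [lintegral_eq_ofReal_mul_lintegral_comp_mul_left hx (f := fun y => gammaPDF a r y *
      (Ioi (0 : ℝ)).indicator (fun z => ENNReal.ofReal (Real.exp (t * z))) (x - y))
    (hp.mul (hm.comp (measurable_const.sub measurable_id))),
    Measure.restrict_congr_set Ioo_ae_eq_Ico,
    ← lintegral_indicator measurableSet_Ico]
  refine lintegral_congr fun u => ?_
  by_cases hu : u ∈ Ico (0 : ℝ) 1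
  · have h1 : x - x * u ∈ Ioi (0 : ℝ) := by
      simp only [mem_Ioi]
      nlinarith [hu.2]
    have := Real.Gamma_pos_of_pos ha
    have := Real.rpow_nonneg hu.1 (a - 1)
    rw [indicator_of_mem hu, indicator_of_mem h1, gammaPDF_of_nonneg (mul_nonneg hx.le hu.1),
      ← ENNReal.ofReal_mul (by have := hu.1; positivity), ← ENNReal.ofReal_mul hx.le]
    congr 1
    have h2 : x ^ a = x * x ^ (a - 1) := by
      rw [Real.rpow_sub_one hx.ne']
      field_simp
    have h3 : Real.exp (t * x - (r + t) * u * x)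
        = Real.exp (-(r * (x * u))) * Real.exp (t * (x - x * u)) := by
      rw [← Real.exp_add]
      ring_nf
    rw [Real.mul_rpow hx.le hu.1, h2, h3]
    ring
  · rw [indicator_of_notMem hu]
    rcases lt_or_ge u 0 with h | h
    · rw [gammaPDF_of_neg (mul_neg_of_pos_of_neg hx h)]
      simp
    · have h1 : x - x * u ∉ Ioi (0 : ℝ) := by
        have : 1 ≤ u := by
          by_contra h'
          exact hu ⟨h, not_le.1 h'⟩
        simp only [mem_Ioi, not_lt]
        nlinarith
      rw [indicator_of_notMem h1]
      simp

/-- The exponential moments of a bilateral Gamma distribution on the positive half-line. -/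
lemma lintegral_indicator_exp_bilateralGammaMeasure {ap lp am lm t : ℝ} (hap : 0 < ap)
    (hlp : 0 < lp) (ham : 0 < am) (hlm : 0 < lm) (htp : t < lp)
    (ht : |-(lm + t) / (lp - t)| < 1) :
    ∫⁻ z, (Ioi (0 : ℝ)).indicator (fun z => ENNReal.ofReal (Real.exp (t * z))) z
        ∂(bilateralGammaMeasure ap lp am lm)
      = ENNReal.ofReal (lp ^ ap * lm ^ am * Real.Gamma (ap + am) /
          (Real.Gamma ap * Real.Gamma (am + 1)) *
          (₂F₁ (ap + am) am (am + 1) (-(lm + t) / (lp - t)) / (lp - t) ^ (ap + am))) := by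
  have := isProbabilityMeasure_gammaMeasure hap hlp
  have := isProbabilityMeasure_gammaMeasure ham hlm
  have hGp := Real.Gamma_pos_of_pos hap
  have hGm := Real.Gamma_pos_of_pos ham
  have hGs := Real.Gamma_pos_of_pos (add_pos hap ham)
  have hlt : 0 < lp - t := sub_pos.2 htp
  have hm : Measurable ((Ioi (0 : ℝ)).indicator fun z => ENNReal.ofReal (Real.exp (t * z))) :=
    Measurable.indicator (by fun_prop) measurableSet_Ioi
  have hp (a r : ℝ) : Measurable (gammaPDF a r) := (measurable_gammaPDFReal a r).ennreal_ofReal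
  set z := -(lm + t) / (lp - t) with hz
  set C := lp ^ ap / Real.Gamma ap * (lm ^ am / Real.Gamma am) with hC
  have hC0 : 0 ≤ C := by positivity
  have hmz : lm + t = -(z * (lp - t)) := by
    rw [hz]
    field_simp
  have hzu {u : ℝ} (hu : u ∈ Ioo (0 : ℝ) 1) : 0 < 1 - z * u := by
    have := abs_lt.1 ht
    nlinarith [hu.1, hu.2]
  rw [bilateralGammaMeasure, lintegral_map hm (by fun_prop),
    lintegral_prod (fun q : ℝ × ℝ => (Ioi (0 : ℝ)).indicator
      (fun z => ENNReal.ofReal (Real.exp (t * z))) (q.1 - q.2))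
      (hm.comp (measurable_fst.sub measurable_snd)).aemeasurable]
  have inner (x : ℝ) : ∫⁻ y, (Ioi (0 : ℝ)).indicator
      (fun z => ENNReal.ofReal (Real.exp (t * z))) (x - y) ∂gammaMeasure am lm
      = ∫⁻ y, gammaPDF am lm y * (Ioi (0 : ℝ)).indicator
      (fun z => ENNReal.ofReal (Real.exp (t * z))) (x - y) :=
    lintegral_withDensity_eq_lintegral_mul _ (hp _ _)
      (hm.comp (measurable_const.sub measurable_id))
  have hmeas : Measurable fun x => ∫⁻ y, gammaPDF am lm y * (Ioi (0 : ℝ)).indicator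
      (fun z => ENNReal.ofReal (Real.exp (t * z))) (x - y) :=
    Measurable.lintegral_prod_right'
      (f := fun q : ℝ × ℝ => gammaPDF am lm q.2 * (Ioi (0 : ℝ)).indicator
        (fun z => ENNReal.ofReal (Real.exp (t * z))) (q.1 - q.2))
      (((hp _ _).comp measurable_snd).mul (hm.comp (measurable_fst.sub measurable_snd)))
  simp only [inner]
  rw [gammaMeasure, lintegral_withDensity_eq_lintegral_mul _ (hp _ _) hmeas]
  calc _ = ∫⁻ x in Ioi (0 : ℝ), ∫⁻ u in Ioo (0 : ℝ) 1, ENNReal.ofReal (C * u ^ (am - 1)) *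
        ENNReal.ofReal (x ^ (ap + am - 1) * Real.exp (-((lp - t) * (1 - z * u) * x))) := by
        rw [← lintegral_indicator measurableSet_Ioi]
        refine lintegral_congr_ae ?_
        filter_upwards [Measure.ae_ne volume (0 : ℝ)] with x hx
        rcases hx.lt_or_gt with h | h
        · rw [indicator_of_notMem (by simpa using h.le), Pi.mul_apply, gammaPDF_of_neg h, zero_mul]
        · rw [indicator_of_mem (by exact h), Pi.mul_apply,
            lintegral_gammaPDF_mul_indicator_exp ham hlm h, gammaPDF_of_nonneg h.le,
            ← lintegral_const_mul _ (by fun_prop)]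
          refine setLIntegral_congr_fun measurableSet_Ioo fun u hu => ?_
          have := Real.rpow_nonneg hu.1.le (am - 1)
          rw [← ENNReal.ofReal_mul (by positivity), ← ENNReal.ofReal_mul (by positivity)]
          congr 1
          have h2 : x ^ (ap + am - 1) = x ^ (ap - 1) * x ^ am := by
            rw [← Real.rpow_add h]
            ring_nf
          have h3 : Real.exp (-((lp - t) * (1 - z * u) * x))
              = Real.exp (-(lp * x)) * Real.exp (t * x - (lm + t) * u * x) := by
            rw [← Real.exp_add, hmz]
            ring_nf
          rw [h2, h3, hC]
          ring
    _ = ∫⁻ u in Ioo (0 : ℝ) 1, ∫⁻ x in Ioi (0 : ℝ), ENNReal.ofReal (C * u ^ (am - 1)) *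
        ENNReal.ofReal (x ^ (ap + am - 1) * Real.exp (-((lp - t) * (1 - z * u) * x))) :=
        lintegral_lintegral_swap (by fun_prop)
    _ = ∫⁻ u in Ioo (0 : ℝ) 1, ENNReal.ofReal (C * Real.Gamma (ap + am) *
        (lp - t) ^ (-(ap + am)) * (u ^ (am - 1) * (1 - z * u) ^ (-(ap + am)))) := by
        refine setLIntegral_congr_fun measurableSet_Ioo fun u hu => ?_
        have := Real.rpow_nonneg hu.1.le (am - 1)
        have h1 := hzu hu
        rw [lintegral_const_mul _ (by fun_prop),
          lintegral_rpow_mul_exp_neg_mul_Ioi (add_pos hap ham) (mul_pos hlt h1),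
          ← ENNReal.ofReal_mul (by positivity), Real.mul_rpow hlt.le h1.le]
        congr 1
        ring
    _ = ENNReal.ofReal (∫ u in Ioo (0 : ℝ) 1, C * Real.Gamma (ap + am) *
        (lp - t) ^ (-(ap + am)) * (u ^ (am - 1) * (1 - z * u) ^ (-(ap + am)))) := by
        rw [ofReal_integral_eq_lintegral_ofReal
          ((integrableOn_rpow_mul_one_sub_mul_rpow _ ham ht).const_mul _)]
        refine ae_restrict_of_forall_mem measurableSet_Ioo fun u hu => ?_
        have h1 := hzu hu
        have := hu.1
        simp only [Pi.zero_apply]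
        positivity
    _ = _ := by
        rw [integral_const_mul, integral_rpow_mul_one_sub_mul_rpow _ ham ht,
          Real.Gamma_add_one ham.ne', Real.rpow_neg hlt.le, hC]
        congr 1
        field_simp

lemma ordinaryHypergeometric_add_one_nonneg (s : ℝ) {a z : ℝ} (ha : 0 < a) (hz : |z| < 1) :
    0 ≤ ₂F₁ s a (a + 1) z := by
  have h := integral_rpow_mul_one_sub_mul_rpow s ha hz
  have h0 : 0 ≤ ∫ u in Ioo (0 : ℝ) 1, u ^ (a - 1) * (1 - z * u) ^ (-s) := by
    refine setIntegral_nonneg measurableSet_Ioo fun u hu => ?_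
    have : 0 < 1 - z * u := by
      have := abs_lt.1 hz
      nlinarith [hu.1, hu.2]
    have := hu.1
    positivity
  rw [h, le_div_iff₀ ha] at h0
  simpa using h0

lemma abs_neg_div_lt_one {x y : ℝ} (hx : 0 < x) (hxy : x < y) : |-x / y| < 1 := by
  rw [abs_div, abs_neg, abs_of_pos hx, abs_of_pos (hx.trans hxy), div_lt_one (hx.trans hxy)]
  exact hxy

/-- for `Z ~ Γ(α⁺,λ⁺;α⁻,λ⁻)` with `λ⁺ > λ⁻ + 2` and `K > 0`, the at-the-money
European Call Option price satisfies
`E[(K e^Z − K)⁺]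
  = K(λ⁺)^{α⁺}(λ⁻)^{α⁻}Γ(α⁺+α⁻)/(Γ(α⁺)Γ(α⁻+1))
    ( ₂F₁(α⁺+α⁻,α⁻;α⁻+1;−(λ⁻+1)/(λ⁺−1))/(λ⁺−1)^{α⁺+α⁻}
      − ₂F₁(α⁺+α⁻,α⁻;α⁻+1;−λ⁻/λ⁺)/(λ⁺)^{α⁺+α⁻} )`. -/
theorem bilateralGamma_atm_call_price (ap am lp lm K : ℝ)
    (hap : 0 < ap) (ham : 0 < am) (hlm : 0 < lm) (hlp : lm + 2 < lp) (hK : 0 < K) :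
    ∫ x, max (K * Real.exp x - K) 0 ∂(bilateralGammaMeasure ap lp am lm)
      = K * lp ^ ap * lm ^ am * Real.Gamma (ap + am) / (Real.Gamma ap * Real.Gamma (am + 1))
        * (₂F₁ (ap + am) am (am + 1) (-(lm + 1) / (lp - 1)) / (lp - 1) ^ (ap + am)
            - ₂F₁ (ap + am) am (am + 1) (-lm / lp) / lp ^ (ap + am)) := by
  have hlp0 : 0 < lp := by linarith
  have hz1 : |-(lm + 1) / (lp - 1)| < 1 := abs_neg_div_lt_one (by linarith) (by linarith)
  have hz0 : |-lm / lp| < 1 := abs_neg_div_lt_one hlm (by linarith)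
  have h1 := lintegral_indicator_exp_bilateralGammaMeasure hap hlp0 ham hlm (by linarith) hz1
  have h0 := lintegral_indicator_exp_bilateralGammaMeasure (t := 0) hap hlp0 ham hlm hlp0
    (by simpa using hz0)
  simp only [add_zero, sub_zero] at h0
  set c := lp ^ ap * lm ^ am * Real.Gamma (ap + am) / (Real.Gamma ap * Real.Gamma (am + 1)) with hc
  set F₁ := ₂F₁ (ap + am) am (am + 1) (-(lm + 1) / (lp - 1)) / (lp - 1) ^ (ap + am) with hF₁
  set F₀ := ₂F₁ (ap + am) am (am + 1) (-lm / lp) / lp ^ (ap + am) with hF₀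
  have hc0 : 0 ≤ c := by
    have := Real.Gamma_pos_of_pos hap
    have := Real.Gamma_pos_of_pos (add_pos hap ham)
    have := Real.Gamma_pos_of_pos (add_pos ham one_pos)
    positivity
  have hF₁0 : 0 ≤ F₁ := div_nonneg (ordinaryHypergeometric_add_one_nonneg _ ham hz1)
    (Real.rpow_nonneg (by linarith) _)
  have hF₀0 : 0 ≤ F₀ := div_nonneg (ordinaryHypergeometric_add_one_nonneg _ ham hz0)
    (Real.rpow_nonneg hlp0.le _)
  have hm (t : ℝ) : Measurable
      ((Ioi (0 : ℝ)).indicator fun z => ENNReal.ofReal (Real.exp (t * z))) :=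
    Measurable.indicator (by fun_prop) measurableSet_Ioi
  have hsplit (z : ℝ) : ENNReal.ofReal (max (K * Real.exp z - K) 0) + ENNReal.ofReal K *
      (Ioi (0 : ℝ)).indicator (fun z => ENNReal.ofReal (Real.exp (0 * z))) z
      = ENNReal.ofReal K *
        (Ioi (0 : ℝ)).indicator (fun z => ENNReal.ofReal (Real.exp (1 * z))) z := by
    by_cases hz : 0 < z
    · have h : K ≤ K * Real.exp z := le_mul_of_one_le_right hK.le (Real.one_le_exp hz.le)
      rw [indicator_of_mem (by exact hz), indicator_of_mem (by exact hz),
        max_eq_left (sub_nonneg.2 h), ← ENNReal.ofReal_mul hK.le, ← ENNReal.ofReal_mul hK.le,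
        ← ENNReal.ofReal_add (sub_nonneg.2 h) (by positivity)]
      simp
    · have h : K * Real.exp z ≤ K :=
        mul_le_of_le_one_right hK.le (Real.exp_le_one_iff.2 (not_lt.1 hz))
      rw [indicator_of_notMem (by exact hz), indicator_of_notMem (by exact hz),
        max_eq_right (sub_nonpos.2 h)]
      simp
  have hsum := lintegral_congr (μ := bilateralGammaMeasure ap lp am lm) hsplit
  rw [lintegral_add_left (by fun_prop), lintegral_const_mul _ (hm 0), lintegral_const_mul _ (hm 1),
    h0, h1, ← ENNReal.ofReal_mul hK.le, ← ENNReal.ofReal_mul hK.le] at hsum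
  rw [integral_eq_lintegral_of_nonneg_ae (f := fun z => max (K * Real.exp z - K) 0)
    (ae_of_all _ fun z => le_max_right _ _)
    (Measurable.aestronglyMeasurable (by fun_prop)),
    ENNReal.eq_sub_of_add_eq ENNReal.ofReal_ne_top hsum, ← ENNReal.ofReal_sub _ (by positivity),
    ENNReal.toReal_ofReal]
  · rw [hc]
    ring
  · have := le_of_add_le_right hsum.le
    rw [ENNReal.ofReal_le_ofReal_iff (by positivity)] at this
    linarith
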